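/- Any Arnoux-Rauzy word over {1,2,3} whose directive sequence starts with 12121 is not 2-balanced, and all its weak partial quotients can simultaneously equal 1 (in the sense that there exist such words with no two consecutive equal letters in the directive sequence). Hence the bound 2h+1 in the balance theorem is optimal for h = 1: there are Arnoux-Rauzy words with all weak partial quotients equal to 1 that are 3-balanced but not 2-balanced. -/

import Mathlib

/-- The Arnoux-Rauzy substitution `σ_i : i ↦ i, j ↦ j i` for `j ≠ i`,
extended to words. Letters 1,2,3 are represented by `0,1,2 : Fin 3`. -/
def sigmaSub {A : Type*} [DecidableEq A] (i : A) (w : List A) : List A :=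
  w.flatMap fun j => if j = i then [i] else [j, i]

/-- `ARword dir n = σ_{i₀} σ_{i₁} ⋯ σ_{i_{n-1}} (1)` for the directive
sequence `dir`, where the letter `1` is represented by `0 : Fin 3`. -/
def ARword (dir : ℕ → Fin 3) (n : ℕ) : List (Fin 3) :=
  ((List.range n).map dir).foldr sigmaSub [0]

/-- `u` is a factor of the infinite word `ω`. -/
def FactorOf {A : Type*} (ω : ℕ → A) (u : List A) : Prop :=
  ∃ k, u = (List.range u.length).map fun t => ω (k + t)

/-- `ω` is an Arnoux-Rauzy word with directive sequence `dir`: every letter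
occurs infinitely often in `dir`, and the factors of `ω` are exactly the
factors of the words `σ_{i₀} ⋯ σ_{i_{n-1}}(1)`. -/
def IsAR (ω : ℕ → Fin 3) (dir : ℕ → Fin 3) : Prop :=
  (∀ a : Fin 3, ∀ m : ℕ, ∃ n, m ≤ n ∧ dir n = a) ∧
  (∀ u : List (Fin 3), FactorOf ω u ↔ ∃ n, u <:+: ARword dir n)

/-- `ω` is `C`-balanced: any two factors of equal length have all letter-count
differences bounded by `C` in absolute value. -/
def IsBalanced {A : Type*} [DecidableEq A] (C : ℕ) (ω : ℕ → A) : Prop :=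
  ∀ u v : List A, FactorOf ω u → FactorOf ω v → u.length = v.length →
    ∀ j : A, |(u.count j : ℤ) - v.count j| ≤ C

/-! ### Basic facts on words -/

lemma sigmaSub_nil (i : Fin 3) : sigmaSub i [] = [] := rfl

lemma sigmaSub_cons (i a : Fin 3) (w : List (Fin 3)) :
    sigmaSub i (a :: w) = (if a = i then [i] else [a, i]) ++ sigmaSub i w := by
  simp [sigmaSub]

lemma sigmaSub_append (i : Fin 3) (w w' : List (Fin 3)) :
    sigmaSub i (w ++ w') = sigmaSub i w ++ sigmaSub i w' := by
  simp [sigmaSub]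

lemma sigmaSub_infix (i : Fin 3) {u w : List (Fin 3)} (h : u <:+: w) :
    sigmaSub i u <:+: sigmaSub i w := by
  obtain ⟨s, t, rfl⟩ := h
  exact ⟨sigmaSub i s, sigmaSub i t, by simp [sigmaSub_append]⟩

lemma sigmaSub_prefix (i : Fin 3) {u w : List (Fin 3)} (h : u <+: w) :
    sigmaSub i u <+: sigmaSub i w := by
  obtain ⟨t, rfl⟩ := h
  exact ⟨sigmaSub i t, by simp [sigmaSub_append]⟩

lemma sigmaSub_count_ne (i j : Fin 3) (h : j ≠ i) (w : List (Fin 3)) :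
    (sigmaSub i w).count j = w.count j := by
  induction w with
  | nil => rfl
  | cons a w ih =>
    rw [sigmaSub_cons, List.count_append, ih]
    split_ifs with ha
    · subst ha; simp [List.count_cons, h.symm]
    · simp [List.count_cons, h.symm]; omega

lemma sigmaSub_count_self (i : Fin 3) (w : List (Fin 3)) :
    (sigmaSub i w).count i = w.length := by
  induction w with
  | nil => rfl
  | cons a w ih =>
    rw [sigmaSub_cons, List.count_append, ih]
    split_ifs with ha
    · simp; omega
    · simp [List.count_cons, ha]; omega

lemma length_eq_counts (w : List (Fin 3)) :
    w.length = w.count 0 + w.count 1 + w.count 2 := by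
  induction w with
  | nil => rfl
  | cons a w ih =>
    fin_cases a <;> simp [List.count_cons, ih] <;> omega

/-- Nonempty images end with the letter `i`. -/
lemma sigmaSub_last (i : Fin 3) (w : List (Fin 3)) (hw : w ≠ []) :
    ∃ p, sigmaSub i w = p ++ [i] := by
  induction w with
  | nil => exact absurd rfl hw
  | cons a w ih =>
    rw [sigmaSub_cons]
    by_cases hw' : w = []
    · subst hw'
      split_ifs
      · exact ⟨[], rfl⟩
      · exact ⟨[a], rfl⟩
    · obtain ⟨p, hp⟩ := ih hw'
      exact ⟨(if a = i then [i] else [a, i]) ++ p, by rw [hp, List.append_assoc]⟩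

lemma ARword_zero (D : ℕ → Fin 3) : ARword D 0 = [0] := rfl

lemma ARword_succ (D : ℕ → Fin 3) (n : ℕ) :
    ARword D (n + 1) = sigmaSub (D 0) (ARword (fun m => D (m + 1)) n) := by
  simp [ARword, List.range_succ_eq_map, Function.comp_def]

lemma sigmaSub_zero_prefix (i : Fin 3) : [0] <+: sigmaSub i [0] := by
  fin_cases i <;> decide

lemma ARword_prefix_succ (n : ℕ) : ∀ D : ℕ → Fin 3, ARword D n <+: ARword D (n + 1) := by
  induction n with
  | zero => intro D; rw [ARword_succ, ARword_zero, ARword_zero]; exact sigmaSub_zero_prefix _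
  | succ n ih =>
    intro D
    rw [ARword_succ D n, ARword_succ D (n + 1)]
    exact sigmaSub_prefix _ (ih _)

lemma ARword_prefix (D : ℕ → Fin 3) {m n : ℕ} (h : m ≤ n) : ARword D m <+: ARword D n := by
  induction n, h using Nat.le_induction with
  | base => exact List.prefix_rfl
  | succ n _ ih => exact ih.trans (ARword_prefix_succ n D)

/-! ### The languages at the various levels -/

/-- `u` belongs to the language of the `k`-th derived word. -/
def InL (D : ℕ → Fin 3) (k : ℕ) (u : List (Fin 3)) : Prop :=
  ∃ n, u <:+: ARword (fun m => D (k + m)) n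

lemma InL.mono {D : ℕ → Fin 3} {k : ℕ} {u v : List (Fin 3)} (h : InL D k v) (huv : u <:+: v) :
    InL D k u := by
  obtain ⟨n, hn⟩ := h
  exact ⟨n, huv.trans hn⟩

lemma ARword_shift (D : ℕ → Fin 3) (k n : ℕ) :
    ARword (fun m => D (k + m)) (n + 1) = sigmaSub (D k) (ARword (fun m => D (k + 1 + m)) n) := by
  rw [ARword_succ]
  simp only [Nat.add_zero]
  congr 2
  funext m
  congr 1
  omega

lemma InL.step {D : ℕ → Fin 3} {k : ℕ} {u : List (Fin 3)} (h : InL D (k + 1) u) :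
    InL D k (sigmaSub (D k) u) := by
  obtain ⟨n, hn⟩ := h
  exact ⟨n + 1, by rw [ARword_shift]; exact sigmaSub_infix _ hn⟩

/-- Every letter occurring later in the directive sequence occurs in the language. -/
lemma InL_letter_aux (D : ℕ → Fin 3) (a : Fin 3) (n : ℕ) :
    ∀ k, D (k + n) = a → InL D k [a] := by
  induction n with
  | zero =>
    intro k hk
    refine ⟨1, ?_⟩
    rw [ARword_shift, ARword_zero]
    simp only [Nat.add_zero] at hk
    rw [hk]
    fin_cases a <;> decide
  | succ n ih =>
    intro k hk
    have h := (ih (k + 1) (by rw [← hk]; congr 1; omega)).step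
    refine h.mono ?_
    rw [sigmaSub_cons]
    split_ifs with ha
    · exact ⟨[], [], by simp [ha, sigmaSub_nil]⟩
    · exact ⟨[], [D k], by simp [sigmaSub_nil]⟩

/-- Every letter occurs infinitely often. -/
def InfOften (D : ℕ → Fin 3) : Prop := ∀ a : Fin 3, ∀ m : ℕ, ∃ n, m ≤ n ∧ D n = a

lemma InL_letter {D : ℕ → Fin 3} (hD : InfOften D) (a : Fin 3) (k : ℕ) : InL D k [a] := by
  obtain ⟨n, hn, h⟩ := hD a k
  exact InL_letter_aux D a (n - k) k (by rw [← h]; congr 1; omega)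

lemma pair_aux : ∀ x i : Fin 3, [i, 0] <:+: sigmaSub i [x, 0] := by decide

lemma InL_pair_aux {D : ℕ → Fin 3} (hD : InfOften D) (n : ℕ) :
    ∀ k, D (k + n) = 0 → ∃ x, InL D k [x, 0] := by
  induction n with
  | zero =>
    intro k hk
    have h := (InL_letter hD 1 (k + 1)).step
    simp only [Nat.add_zero] at hk
    rw [hk] at h
    exact ⟨1, h⟩
  | succ n ih =>
    intro k hk
    obtain ⟨x, hx⟩ := ih (k + 1) (by rw [← hk]; congr 1; omega)
    exact ⟨D k, hx.step.mono (pair_aux x (D k))⟩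

lemma ARword_left_ext {D : ℕ → Fin 3} (hD : InfOften D) (n : ℕ) :
    ∀ k, ∃ x, InL D k (x :: ARword (fun m => D (k + m)) n) := by
  induction n with
  | zero =>
    intro k
    obtain ⟨m, hm, h⟩ := hD 0 k
    exact InL_pair_aux hD (m - k) k (by rw [← h]; congr 1; omega)
  | succ n ih =>
    intro k
    obtain ⟨x, hx⟩ := ih (k + 1)
    refine ⟨D k, hx.step.mono ?_⟩
    rw [ARword_shift, sigmaSub_cons]
    split_ifs with h
    · exact ⟨[], [], by simp⟩
    · exact ⟨[x], [], by simp⟩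

lemma InL.left_ext {D : ℕ → Fin 3} (hD : InfOften D) {k : ℕ} {u : List (Fin 3)}
    (h : InL D k u) : ∃ x, InL D k (x :: u) := by
  obtain ⟨n, s, t, hn⟩ := h
  rcases List.eq_nil_or_concat s with rfl | ⟨s', y, rfl⟩
  · obtain ⟨x, hx⟩ := ARword_left_ext hD n k
    refine ⟨x, hx.mono ⟨[], t, ?_⟩⟩
    rw [← hn]; simp
  · exact ⟨y, n, s', t, by rw [← hn]; simp⟩

/-- Extension of an image on the left. -/
lemma InL.step_plus {D : ℕ → Fin 3} (hD : InfOften D) {k : ℕ} {u : List (Fin 3)}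
    (h : InL D (k + 1) u) : InL D k (D k :: sigmaSub (D k) u) := by
  obtain ⟨x, hx⟩ := h.left_ext hD
  refine hx.step.mono ?_
  rw [sigmaSub_cons]
  split_ifs with h
  · exact ⟨[], [], by simp⟩
  · exact ⟨[x], [], by simp⟩

lemma word_plus {D : ℕ → Fin 3} (hD : InfOften D) {k : ℕ} {u : List (Fin 3)}
    (h : InL D (k + 1) u) : ∃ u', u' ≠ [] ∧ InL D k u' ∧
      (u'.count (D k) : ℤ) = u.length + 1 ∧ ∀ j, j ≠ D k → u'.count j = u.count j := by
  refine ⟨_, by simp, h.step_plus hD, ?_, ?_⟩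
  · rw [List.count_cons_self, sigmaSub_count_self]; push_cast; rfl
  · intro j hj
    rw [List.count_cons_of_ne hj.symm, sigmaSub_count_ne _ _ hj]

lemma word_zero {D : ℕ → Fin 3} {k : ℕ} {u : List (Fin 3)}
    (h : InL D (k + 1) u) (hu : u ≠ []) : ∃ u', u' ≠ [] ∧ InL D k u' ∧
      (u'.count (D k) : ℤ) = u.length ∧ ∀ j, j ≠ D k → u'.count j = u.count j := by
  refine ⟨_, ?_, h.step, ?_, ?_⟩
  · obtain ⟨p, hp⟩ := sigmaSub_last (D k) u hu
    rw [hp]; simp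
  · rw [sigmaSub_count_self]
  · intro j hj
    rw [sigmaSub_count_ne _ _ hj]

lemma word_minus {D : ℕ → Fin 3} {k : ℕ} {u : List (Fin 3)}
    (h : InL D (k + 1) u) (hu : ∃ j, j ≠ D k ∧ 0 < u.count j) : ∃ u', u' ≠ [] ∧ InL D k u' ∧
      (u'.count (D k) : ℤ) = u.length - 1 ∧ ∀ j, j ≠ D k → u'.count j = u.count j := by
  obtain ⟨j, hj, hc⟩ := hu
  have hu : u ≠ [] := by rintro rfl; simp at hc
  obtain ⟨p, hp⟩ := sigmaSub_last (D k) u hu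
  have hcount : ∀ j, j ≠ D k → p.count j = u.count j := by
    intro j hj
    rw [← sigmaSub_count_ne _ _ hj u, hp, List.count_append,
      List.count_eq_zero_of_not_mem (l := [D k]) (by simpa using hj)]
    rfl
  refine ⟨p, ?_, h.step.mono ⟨[], [D k], by rw [hp]; rfl⟩, ?_, hcount⟩
  · rintro rfl
    have := hcount j hj
    simp at this; omega
  · have h1 := sigmaSub_count_self (D k) u
    rw [hp, List.count_append] at h1
    simp at h1
    omega

/-- The vector `d` is the difference of the Parikh vectors of two nonempty words of level `k`. -/
def Rz (D : ℕ → Fin 3) (k : ℕ) (d : Fin 3 → ℤ) : Prop :=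
  ∃ u v : List (Fin 3), u ≠ [] ∧ v ≠ [] ∧ InL D k u ∧ InL D k v ∧
    ∀ j, (u.count j : ℤ) - v.count j = d j

lemma Rz.neg {D : ℕ → Fin 3} {k : ℕ} {d : Fin 3 → ℤ} (h : Rz D k d) : Rz D k (fun j => - d j) := by
  obtain ⟨u, v, hu, hv, hu', hv', h⟩ := h
  exact ⟨v, u, hv, hu, hv', hu', fun j => by beta_reduce; rw [← h j]; ring⟩

lemma Rz.step_nonpos {D : ℕ → Fin 3} (hD : InfOften D) {k : ℕ} {d : Fin 3 → ℤ}
    (h : Rz D (k + 1) d) (c : ℤ) (h1 : -2 ≤ c) (h2 : c ≤ 0)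
    (hp : ∃ j, j ≠ D k ∧ 0 < d j) :
    Rz D k (fun j => if j = D k then d 0 + d 1 + d 2 + c else d j) := by
  obtain ⟨u, v, hu, hv, hu', hv', h⟩ := h
  have hlen : (u.length : ℤ) - v.length = d 0 + d 1 + d 2 := by
    rw [length_eq_counts u, length_eq_counts v, ← h 0, ← h 1, ← h 2]; push_cast; ring
  have hm : ∃ j, j ≠ D k ∧ 0 < u.count j := by
    obtain ⟨j, hj, hd⟩ := hp
    refine ⟨j, hj, ?_⟩
    have := h j
    omega
  obtain ⟨um, hum, hum1, hum2, hum3⟩ := word_minus hu' hm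
  obtain ⟨uz, huz, huz1, huz2, huz3⟩ := word_zero hu' hu
  obtain ⟨vz, hvz, hvz1, hvz2, hvz3⟩ := word_zero hv' hv
  obtain ⟨vp, hvp, hvp1, hvp2, hvp3⟩ := word_plus hD hv'
  have hc : c = -2 ∨ c = -1 ∨ c = 0 := by omega
  rcases hc with rfl | rfl | rfl
  · refine ⟨um, vp, hum, hvp, hum1, hvp1, fun j => ?_⟩
    beta_reduce
    by_cases hj : j = D k
    · rw [if_pos hj, hj, hum2, hvp2]; linarith
    · rw [if_neg hj, hum3 j hj, hvp3 j hj, h j]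
  · refine ⟨um, vz, hum, hvz, hum1, hvz1, fun j => ?_⟩
    beta_reduce
    by_cases hj : j = D k
    · rw [if_pos hj, hj, hum2, hvz2]; linarith
    · rw [if_neg hj, hum3 j hj, hvz3 j hj, h j]
  · refine ⟨uz, vz, huz, hvz, huz1, hvz1, fun j => ?_⟩
    beta_reduce
    by_cases hj : j = D k
    · rw [if_pos hj, hj, huz2, hvz2]; linarith
    · rw [if_neg hj, huz3 j hj, hvz3 j hj, h j]

lemma Rz.step_nonneg {D : ℕ → Fin 3} (hD : InfOften D) {k : ℕ} {d : Fin 3 → ℤ}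
    (h : Rz D (k + 1) d) (c : ℤ) (h1 : 0 ≤ c) (h2 : c ≤ 2)
    (hp : ∃ j, j ≠ D k ∧ d j < 0) :
    Rz D k (fun j => if j = D k then d 0 + d 1 + d 2 + c else d j) := by
  obtain ⟨j, hj, hd⟩ := hp
  have := (h.neg.step_nonpos hD (-c) (by omega) (by omega) ⟨j, hj, by omega⟩).neg
  convert this using 2
  split_ifs <;> ring

/-- The vector with coordinate `x` at the letter `0`, `y` at `b`, and `z` at the last letter,
where `b` is the letter `1` if `s` is false and the letter `2` if `s` is true. -/
def vec (s : Bool) (x y z : ℤ) : Fin 3 → ℤ := if s then ![x, z, y] else ![x, y, z]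

/-- The letter with coordinate `y` in `vec`. -/
def ltB (s : Bool) : Fin 3 := if s then 2 else 1

/-- The letter with coordinate `z` in `vec`. -/
def ltC (s : Bool) : Fin 3 := if s then 1 else 2

lemma letter_cases (s : Bool) (a : Fin 3) : a = 0 ∨ a = ltB s ∨ a = ltC s := by
  revert s a; decide

lemma Rz.congr {D : ℕ → Fin 3} {k : ℕ} {d d' : Fin 3 → ℤ} (h : Rz D k d) (hd : ∀ j, d j = d' j) :
    Rz D k d' := by
  obtain rfl : d = d' := funext hd
  exact h

/-- A step at the letter `0` with a negative last coordinate. -/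
lemma Rz.up0 {D : ℕ → Fin 3} (hD : InfOften D) {k : ℕ} (s : Bool) {x y z : ℤ}
    (h : Rz D (k + 1) (vec s x y z)) (hk : D k = 0) (x' : ℤ) (hz : z < 0)
    (h1 : x + y + z ≤ x') (h2 : x' ≤ x + y + z + 2) : Rz D k (vec s x' y z) := by
  refine (h.step_nonneg hD (x' - (x + y + z)) (by omega) (by omega)
    ⟨ltC s, ?_, ?_⟩).congr ?_
  · rw [hk]; cases s <;> decide
  · cases s <;> simpa [vec, ltC] using hz
  · rw [hk]; intro j; cases s <;> fin_cases j <;> simp [vec] <;> ring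

/-- A step at the letter `b` with a negative last coordinate. -/
lemma Rz.upB {D : ℕ → Fin 3} (hD : InfOften D) {k : ℕ} (s : Bool) {x y z : ℤ}
    (h : Rz D (k + 1) (vec s x y z)) (hk : D k = ltB s) (y' : ℤ) (hz : z < 0)
    (h1 : x + y + z ≤ y') (h2 : y' ≤ x + y + z + 2) : Rz D k (vec s x y' z) := by
  refine (h.step_nonneg hD (y' - (x + y + z)) (by omega) (by omega)
    ⟨ltC s, ?_, ?_⟩).congr ?_
  · rw [hk]; cases s <;> decide
  · cases s <;> simpa [vec, ltC] using hz
  · rw [hk]; intro j; cases s <;> fin_cases j <;> simp [vec, ltB] <;> ring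

/-- A downwards step at the last letter. -/
lemma Rz.downC {D : ℕ → Fin 3} (hD : InfOften D) {k : ℕ} (s : Bool) {x y z : ℤ}
    (h : Rz D (k + 1) (vec s x y z)) (hk : D k = ltC s) (z' : ℤ) (hxy : 0 < x ∨ 0 < y)
    (h1 : x + y + z - 2 ≤ z') (h2 : z' ≤ x + y + z) : Rz D k (vec s x y z') := by
  refine (h.step_nonpos hD (z' - (x + y + z)) (by omega) (by omega) ?_).congr ?_
  · rcases hxy with hx | hy
    · refine ⟨0, ?_, ?_⟩
      · rw [hk]; cases s <;> decide
      · cases s <;> simpa [vec] using hx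
    · refine ⟨ltB s, ?_, ?_⟩
      · rw [hk]; cases s <;> decide
      · cases s <;> simpa [vec, ltB] using hy
  · rw [hk]; intro j; cases s <;> fin_cases j <;> simp [vec, ltC] <;> ring

/-- A downwards step at the letter `0`. -/
lemma Rz.down0 {D : ℕ → Fin 3} (hD : InfOften D) {k : ℕ} (s : Bool) {x y z : ℤ}
    (h : Rz D (k + 1) (vec s x y z)) (hk : D k = 0) (x' : ℤ) (hy : 0 < y)
    (h1 : x + y + z - 2 ≤ x') (h2 : x' ≤ x + y + z) : Rz D k (vec s x' y z) := by
  refine (h.step_nonpos hD (x' - (x + y + z)) (by omega) (by omega) ⟨ltB s, ?_, ?_⟩).congr ?_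
  · rw [hk]; cases s <;> decide
  · cases s <;> simpa [vec, ltB] using hy
  · rw [hk]; intro j; cases s <;> fin_cases j <;> simp [vec] <;> ring

lemma Rz_letters {D : ℕ → Fin 3} (hD : InfOften D) (k : ℕ) (s : Bool) :
    Rz D k (vec s 1 0 (-1)) ∧ Rz D k (vec s 0 1 (-1)) := by
  constructor
  · refine ⟨[0], [ltC s], by simp, by simp, InL_letter hD _ k, InL_letter hD _ k, ?_⟩
    revert s; decide
  · refine ⟨[ltB s], [ltC s], by simp, by simp, InL_letter hD _ k, InL_letter hD _ k, ?_⟩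
    revert s; decide

lemma phaseA {D : ℕ → Fin 3} (hD : InfOften D) (s : Bool) (n : ℕ) :
    ∀ k, D (k + n) = ltC s → Rz D k (vec s 1 0 (-2)) ∧ Rz D k (vec s 0 1 (-2)) := by
  induction n with
  | zero =>
    intro k hk
    obtain ⟨h1, h2⟩ := Rz_letters hD (k + 1) s
    exact ⟨h1.downC hD s hk _ (by omega) (by omega) (by omega),
      h2.downC hD s hk _ (by omega) (by omega) (by omega)⟩
  | succ n ih =>
    intro k hk
    rcases letter_cases s (D k) with h | h | h
    · obtain ⟨h1, h2⟩ := ih (k + 1) (by rw [← hk]; congr 1; omega)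
      exact ⟨h1.up0 hD s h _ (by omega) (by omega) (by omega),
        h2.up0 hD s h _ (by omega) (by omega) (by omega)⟩
    · obtain ⟨h1, h2⟩ := ih (k + 1) (by rw [← hk]; congr 1; omega)
      exact ⟨h1.upB hD s h _ (by omega) (by omega) (by omega),
        h2.upB hD s h _ (by omega) (by omega) (by omega)⟩
    · obtain ⟨h1, h2⟩ := Rz_letters hD (k + 1) s
      exact ⟨h1.downC hD s h _ (by omega) (by omega) (by omega),
        h2.downC hD s h _ (by omega) (by omega) (by omega)⟩

lemma phaseA' {D : ℕ → Fin 3} (hD : InfOften D) (s : Bool) (k : ℕ) :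
    Rz D k (vec s 1 0 (-2)) ∧ Rz D k (vec s 0 1 (-2)) := by
  obtain ⟨m, hm, h⟩ := hD (ltC s) k
  exact phaseA hD s (m - k) k (by rw [← h]; congr 1; omega)

lemma phaseB {D : ℕ → Fin 3} (hD : InfOften D) (s : Bool) (n : ℕ) :
    ∀ k, D (k + n) = 0 → Rz D k (vec s 1 1 (-2)) := by
  have key0 : ∀ k, D k = 0 → Rz D k (vec s 1 1 (-2)) := fun k hk =>
    (phaseA' hD s (k + 1)).2.up0 hD s hk _ (by omega) (by omega) (by omega)
  induction n with
  | zero => exact fun k hk => key0 k hk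
  | succ n ih =>
    intro k hk
    rcases letter_cases s (D k) with h | h | h
    · exact key0 k h
    · exact (phaseA' hD s (k + 1)).1.upB hD s h _ (by omega) (by omega) (by omega)
    · have h1 := ih (k + 1) (by rw [← hk]; congr 1; omega)
      exact h1.downC hD s h _ (by omega) (by omega) (by omega)

lemma phaseC {D : ℕ → Fin 3} (hD : InfOften D) (s : Bool) (k : ℕ) (hk : D k = ltB s) :
    Rz D k (vec s 1 2 (-2)) := by
  obtain ⟨m, hm, h⟩ := hD 0 (k + 1)
  have h1 := phaseB hD s (m - (k + 1)) (k + 1) (by rw [← h]; congr 1; omega)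
  exact h1.upB hD s hk _ (by omega) (by omega) (by omega)

lemma phaseC' {D : ℕ → Fin 3} (hD : InfOften D) (k : ℕ) (hk : D k ≠ 0) :
    Rz D k (vec false 1 2 (-2)) ∨ Rz D k (vec false (-1) 2 (-2)) := by
  rcases letter_cases false (D k) with h | h | h
  · exact absurd h hk
  · exact Or.inl (phaseC hD false k h)
  · right
    refine (phaseC hD true k h).neg.congr ?_
    decide

lemma phaseD {D : ℕ → Fin 3} (hD : InfOften D) (n : ℕ) :
    ∀ k, D (k + n) = 1 →
      Rz D k (vec false 1 2 (-2)) ∨ Rz D k (vec false (-1) 2 (-2)) := by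
  induction n with
  | zero => intro k hk; exact phaseC' hD k (by rw [show D k = 1 from hk]; decide)
  | succ n ih =>
    intro k hk
    by_cases h : D k = 0
    · rcases ih (k + 1) (by rw [← hk]; congr 1; omega) with h1 | h1
      · exact Or.inl (h1.up0 hD false h _ (by omega) (by omega) (by omega))
      · exact Or.inr (h1.up0 hD false h _ (by omega) (by omega) (by omega))
    · exact phaseC' hD k h

lemma final_vector {D : ℕ → Fin 3} (hD : InfOften D) (h0 : D 0 = 0) (h1 : D 1 = 1) (h2 : D 2 = 0)
    (h3 : D 3 = 1) (h4 : D 4 = 0) : Rz D 0 (vec false (-1) 3 (-2)) := by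
  obtain ⟨m, hm, h⟩ := hD 1 5
  have r4 : Rz D 4 (vec false 1 2 (-2)) := by
    rcases phaseD hD (m - 5) 5 (by rw [← h]; congr 1; omega) with h5 | h5
    · exact h5.up0 hD false h4 _ (by omega) (by omega) (by omega)
    · exact h5.up0 hD false h4 _ (by omega) (by omega) (by omega)
  have r3 : Rz D 3 (vec false 1 3 (-2)) :=
    r4.upB hD false h3 _ (by omega) (by omega) (by omega)
  have r2 : Rz D 2 (vec false 0 3 (-2)) :=
    r3.down0 hD false h2 _ (by omega) (by omega) (by omega)
  have r1 : Rz D 1 (vec false 0 3 (-2)) :=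
    r2.upB hD false h1 _ (by omega) (by omega) (by omega)
  exact r1.down0 hD false h0 _ (by omega) (by omega) (by omega)

lemma not_two_balanced (ω D : ℕ → Fin 3) (hω : IsAR ω D) (h0 : D 0 = 0) (h1 : D 1 = 1)
    (h2 : D 2 = 0) (h3 : D 3 = 1) (h4 : D 4 = 0) : ¬ IsBalanced 2 ω := by
  intro hb
  obtain ⟨u, v, -, -, ⟨m, hu⟩, ⟨n, hv⟩, hd⟩ := final_vector hω.1 h0 h1 h2 h3 h4
  simp only [Nat.zero_add] at hu hv
  have d0 := hd 0
  have d1 := hd 1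
  have d2 := hd 2
  simp [vec] at d0 d1 d2
  have := hb u v ((hω.2 u).2 ⟨m, hu⟩) ((hω.2 v).2 ⟨n, hv⟩)
    (by rw [length_eq_counts u, length_eq_counts v]; omega) 1
  rw [d1] at this
  norm_num at this

/-! ### Existence of the infinite word -/

lemma sigmaSub_len (i j : Fin 3) (h : j ≠ i) (w : List (Fin 3)) :
    w.length + w.count j ≤ (sigmaSub i w).length := by
  have h1 := sigmaSub_count_self i w
  have h2 := sigmaSub_count_ne i j h w
  have h3 := length_eq_counts (sigmaSub i w)
  fin_cases i <;> fin_cases j <;> simp_all <;> omega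

lemma ARword_ne_nil (D : ℕ → Fin 3) (n : ℕ) : 1 ≤ (ARword D n).length := by
  have := (ARword_prefix D (Nat.zero_le n)).length_le
  simpa [ARword_zero] using this

lemma ARword_growth (k : ℕ) : ∀ D : ℕ → Fin 3, (∀ m, D m ≠ D (m + 1)) →
    k + 1 ≤ (ARword D (2 * k)).length := by
  induction k with
  | zero => intro D _; exact ARword_ne_nil D 0
  | succ k ih =>
    intro D hD
    have h1 := ih (fun m => D (m + 1 + 1)) (fun m => hD (m + 1 + 1))
    rw [show 2 * (k + 1) = 2 * k + 1 + 1 by ring, ARword_succ, ARword_succ]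
    have h2 := sigmaSub_len (D 0) (D (0 + 1)) (hD 0).symm
      (sigmaSub (D (0 + 1)) (ARword (fun m => D (m + 1 + 1)) (2 * k)))
    rw [sigmaSub_count_self] at h2
    have h3 : (sigmaSub (D (0 + 1)) (ARword (fun m => D (m + 1 + 1)) (2 * k))).count (D (0 + 1))
        ≤ _ := List.count_le_length
    rw [sigmaSub_count_self] at h3
    omega

/-- The infinite word generated by a directive sequence. -/
def limWord (D : ℕ → Fin 3) (k : ℕ) : Fin 3 := (ARword D (2 * k)).getD k 0

lemma limWord_eq (D : ℕ → Fin 3) (hD : ∀ m, D m ≠ D (m + 1)) (k n : ℕ)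
    (hk : k < (ARword D n).length) : limWord D k = (ARword D n)[k] := by
  have hk' : k < (ARword D (2 * k)).length := ARword_growth k D hD
  have e : limWord D k = (ARword D (2 * k))[k] := by
    exact List.getD_eq_getElem _ _ hk'
  rw [e]
  rcases le_total (2 * k) n with h | h
  · exact (ARword_prefix D h).getElem hk'
  · exact ((ARword_prefix D h).getElem hk).symm

lemma limWord_factor (D : ℕ → Fin 3) (hD : ∀ m, D m ≠ D (m + 1)) (u : List (Fin 3)) :
    FactorOf (limWord D) u ↔ ∃ n, u <:+: ARword D n := by
  constructor
  · rintro ⟨k, hk⟩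
    refine ⟨2 * (k + u.length), ?_⟩
    have hlen := ARword_growth (k + u.length) D hD
    have : u = ((ARword D (2 * (k + u.length))).drop k).take u.length := by
      conv_lhs => rw [hk]
      apply List.ext_getElem
      · simp; omega
      · intro i h1 h2
        simp at h1
        simp only [List.getElem_map, List.getElem_range, List.getElem_take, List.getElem_drop]
        exact limWord_eq D hD _ _ _
    have h3 : ((ARword D (2 * (k + u.length))).drop k).take u.length <:+:
        ARword D (2 * (k + u.length)) :=
      (List.take_prefix _ _).isInfix.trans (List.drop_suffix _ _).isInfix
    rwa [← this] at h3
  · rintro ⟨n, s, t, h⟩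
    refine ⟨s.length, ?_⟩
    apply List.ext_getElem
    · simp
    · intro i h1 h2
      simp only [List.getElem_map, List.getElem_range]
      rw [limWord_eq D hD _ n (by rw [← h]; simp; omega)]
      simp [← h, List.getElem_append, h1]

/-! ### Desubstitution -/

lemma desub_prefix (i : Fin 3) (w : List (Fin 3)) : ∀ p, p <+: sigmaSub i w →
    ∃ p', p' <+: w ∧ (∀ j, j ≠ i → p.count j = p'.count j) ∧
      (p.count i = p'.length ∨ p.count i + 1 = p'.length) := by
  induction w with
  | nil =>
    intro p hp
    rw [sigmaSub_nil, List.prefix_nil] at hp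
    subst hp
    exact ⟨[], List.prefix_rfl, by simp, by simp⟩
  | cons a w ih =>
    intro p hp
    rw [sigmaSub_cons] at hp
    cases p with
    | nil => exact ⟨[], List.nil_prefix, by simp, by simp⟩
    | cons b p =>
      split_ifs at hp with ha
      · rw [List.singleton_append, List.cons_prefix_cons] at hp
        obtain ⟨rfl, hp⟩ := hp
        obtain ⟨p', h1, h2, h3⟩ := ih p hp
        subst ha
        refine ⟨a :: p', by simpa using h1, ?_, ?_⟩
        · intro j hj
          rw [List.count_cons_of_ne hj.symm, List.count_cons_of_ne hj.symm, h2 j hj]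
        · simp; omega
      · rw [List.cons_append, List.singleton_append, List.cons_prefix_cons] at hp
        obtain ⟨rfl, hp⟩ := hp
        cases p with
        | nil =>
          refine ⟨[b], by simp, fun _ _ => rfl, ?_⟩
          right
          simp [ha]
        | cons e p =>
          rw [List.cons_prefix_cons] at hp
          obtain ⟨rfl, hp⟩ := hp
          obtain ⟨p', h1, h2, h3⟩ := ih p hp
          refine ⟨b :: p', by simpa using h1, ?_, ?_⟩
          · intro j hj
            simp [List.count_cons, h2 j hj, hj.symm]
          · simp [List.count_cons, ha]; omega

lemma count_add_le (i : Fin 3) (p : List (Fin 3)) : p.count i ≤ p.length := List.count_le_length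

lemma desub (i : Fin 3) (w u : List (Fin 3)) (h : u <:+: sigmaSub i w) :
    ∃ u' : List (Fin 3), ∃ c : ℤ, u' <:+: w ∧ -1 ≤ c ∧ c ≤ 1 ∧
      (∀ j, j ≠ i → u.count j = u'.count j) ∧ (u.count i : ℤ) = u'.length + c := by
  obtain ⟨s, t, hst⟩ := h
  obtain ⟨p, hp, hp1, hp2⟩ := desub_prefix i w s ⟨u ++ t, by rw [← hst]; simp⟩
  obtain ⟨q, hq, hq1, hq2⟩ := desub_prefix i w (s ++ u) ⟨t, hst⟩
  simp only [List.count_append] at hq1 hq2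
  rcases le_total p.length q.length with hle | hle
  · obtain ⟨r, rfl⟩ := List.prefix_of_prefix_length_le hp hq hle
    refine ⟨r, (u.count i : ℤ) - r.length, ?_, ?_, ?_, ?_, by ring⟩
    · obtain ⟨t', ht'⟩ := hq
      exact ⟨p, t', ht'⟩
    · rw [List.length_append] at hq2; omega
    · rw [List.length_append] at hq2; omega
    · intro j hj
      have a1 := hp1 j hj
      have a2 := hq1 j hj
      rw [List.count_append] at a2
      omega
  · obtain ⟨r, rfl⟩ := List.prefix_of_prefix_length_le hq hp hle
    refine ⟨[], u.count i, List.nil_infix, by omega, ?_, ?_, by simp⟩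
    · rw [List.length_append] at hp2; omega
    · intro j hj
      have a1 := hp1 j hj
      have a2 := hq1 j hj
      rw [List.count_append] at a1
      simp; omega

lemma desub_pair (i : Fin 3) (w w' u v : List (Fin 3)) (hu : u <:+: sigmaSub i w)
    (hv : v <:+: sigmaSub i w') :
    ∃ u' v' : List (Fin 3), ∃ c : ℤ, u' <:+: w ∧ v' <:+: w' ∧ -2 ≤ c ∧ c ≤ 2 ∧
      (∀ j, j ≠ i → (u.count j : ℤ) - v.count j = u'.count j - v'.count j) ∧
      (u.count i : ℤ) - v.count i = (u'.count 0 - v'.count 0) + (u'.count 1 - v'.count 1)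
        + (u'.count 2 - v'.count 2) + c := by
  obtain ⟨u', c, h1, h2, h3, h4, h5⟩ := desub i w u hu
  obtain ⟨v', c', k1, k2, k3, k4, k5⟩ := desub i w' v hv
  refine ⟨u', v', c - c', h1, k1, by omega, by omega, ?_, ?_⟩
  · intro j hj; rw [h4 j hj, k4 j hj]
  · rw [h5, k5, length_eq_counts u', length_eq_counts v']; push_cast; ring

/-! ### The periodic tail -/

/-- The directive sequence `a, a - 1, a - 2, …` modulo three. -/
def tailDir : Fin 3 → ℕ → Fin 3
  | a, 0 => a
  | a, m + 1 => tailDir (a - 1) m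

/-- The quadratic form controlling the tail. -/
def qf (x y z : ℤ) : ℤ := 4*x^2 - 16*x*y - 10*x*z + 11*y^2 + 2*y*z + 9*z^2

lemma qf_step (x y z c : ℤ) (h : qf x y z ≤ 288) (h1 : -2 ≤ c) (h2 : c ≤ 2) :
    qf (x + y + z + c) x y ≤ 288 := by
  have hc : c ^ 2 ≤ 4 := by nlinarith
  unfold qf at *
  have key : (0:ℚ) ≤ (4*x^2 - 16*x*y - 10*x*z + 11*y^2 + 2*y*z + 9*z^2) + 24 * c^2
      - 4/3 * (4*(x+y+z+c)^2 - 16*(x+y+z+c)*x - 10*(x+y+z+c)*y + 11*x^2 + 2*x*y + 9*y^2) := by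
    have e : (4*x^2 - 16*x*y - 10*x*z + 11*y^2 + 2*y*z + 9*z^2) + 24 * c^2
      - 4/3 * (4*(x+y+z+c)^2 - 16*(x+y+z+c)*x - 10*(x+y+z+c)*y + 11*x^2 + 2*x*y + 9*y^2)
      = 16/3 * (x + y/2 + z/16 + c)^2 + 17/3 * (y + 13/34*z - 4/17*c)^2
        + 2299/816 * (z - 4208/2299*c)^2 + (8232/2299 * c^2 : ℚ) := by ring
    rw [e]; positivity
  have hq : ((4*x^2 - 16*x*y - 10*x*z + 11*y^2 + 2*y*z + 9*z^2 : ℤ) : ℚ) ≤ 288 := by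
    exact_mod_cast h
  have hcq : ((c^2 : ℤ) : ℚ) ≤ 4 := by exact_mod_cast hc
  push_cast at hq hcq
  have : ((4*(x+y+z+c)^2 - 16*(x+y+z+c)*x - 10*(x+y+z+c)*y + 11*x^2 + 2*x*y + 9*y^2 : ℤ) : ℚ)
      ≤ 288 := by
    push_cast; linarith
  exact_mod_cast this

/-- Difference of letter counts. -/
def dc (u v : List (Fin 3)) (j : Fin 3) : ℤ := (u.count j : ℤ) - v.count j

lemma infix_singleton_count (u : List (Fin 3)) (h : u <:+: [0]) :
    u.count 1 = 0 ∧ u.count 2 = 0 ∧ u.count 0 ≤ 1 := by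
  have h0 := h.sublist.count_le 0
  have h1 := h.sublist.count_le 1
  have h2 := h.sublist.count_le 2
  simp at h0 h1 h2
  simp [h1, h2, h0]

lemma fin3_facts : ∀ a : Fin 3, a - 1 ≠ a ∧ a - 2 ≠ a ∧ a - 1 - 1 = a - 2 := by decide

lemma tail_bound (n : ℕ) : ∀ (a : Fin 3) (u v : List (Fin 3)),
    u <:+: ARword (tailDir a) n → v <:+: ARword (tailDir a) n →
    qf (dc u v a) (dc u v (a - 1)) (dc u v (a - 2)) ≤ 288 := by
  induction n with
  | zero =>
    intro a u v hu hv
    obtain ⟨u1, u2, u0⟩ := infix_singleton_count u hu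
    obtain ⟨v1, v2, v0⟩ := infix_singleton_count v hv
    have e1 : dc u v 1 = 0 := by simp [dc, u1, v1]
    have e2 : dc u v 2 = 0 := by simp [dc, u2, v2]
    have e0 : dc u v 0 ^ 2 ≤ 1 := by
      have : -1 ≤ dc u v 0 ∧ dc u v 0 ≤ 1 := by unfold dc; omega
      nlinarith
    fin_cases a
    · show qf (dc u v 0) (dc u v 2) (dc u v 1) ≤ 288
      rw [e1, e2, qf]; linarith
    · show qf (dc u v 1) (dc u v 0) (dc u v 2) ≤ 288
      rw [e1, e2, qf]; linarith
    · show qf (dc u v 2) (dc u v 1) (dc u v 0) ≤ 288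
      rw [e1, e2, qf]; linarith
  | succ n ih =>
    intro a u v hu hv
    rw [ARword_succ] at hu hv
    obtain ⟨u', v', c, h1, h2, h3, h4, h5, h6⟩ := desub_pair _ _ _ u v hu hv
    have h := ih (a - 1) u' v' h1 h2
    have h7 := qf_step _ _ _ c h h3 h4
    have e0 : dc u v a = dc u' v' (a - 1) + dc u' v' (a - 1 - 1) + dc u' v' (a - 1 - 2) + c := by
      refine Eq.trans h6 ?_
      fin_cases a
      · show _ = dc u' v' 2 + dc u' v' 1 + dc u' v' 0 + c
        unfold dc; ring
      · show _ = dc u' v' 0 + dc u' v' 2 + dc u' v' 1 + c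
        unfold dc; ring
      · show _ = dc u' v' 1 + dc u' v' 0 + dc u' v' 2 + c
        unfold dc; ring
    have e1 : dc u v (a - 1) = dc u' v' (a - 1) :=
      h5 _ (by show a - 1 ≠ a; exact (fin3_facts a).1)
    have e2 : dc u v (a - 2) = dc u' v' (a - 1 - 1) := by
      have : a - 1 - 1 = a - 2 := (fin3_facts a).2.2
      rw [this]
      exact h5 _ (by show a - 2 ≠ a; exact (fin3_facts a).2.1)
    rw [e0, e1, e2]
    exact h7

/-! ### The example -/

/-- The directive sequence of the example. -/
def exDir : ℕ → Fin 3
  | 0 => 0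
  | 1 => 1
  | 2 => 0
  | 3 => 1
  | 4 => 0
  | m + 5 => tailDir 2 m

lemma tailDir_ne (m : ℕ) : ∀ a, tailDir a m ≠ tailDir a (m + 1) := by
  induction m with
  | zero => decide
  | succ m ih => intro a; exact ih (a - 1)

lemma tailDir_add (k j : ℕ) : tailDir 2 (j + 3 * k) = tailDir 2 j := by
  induction k with
  | zero => rfl
  | succ k ih =>
    rw [← ih]
    rfl

lemma exDir_ne (m : ℕ) : exDir m ≠ exDir (m + 1) := by
  match m with
  | 0 => decide
  | 1 => decide
  | 2 => decide
  | 3 => decide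
  | 4 => decide
  | m + 5 => exact tailDir_ne m 2

lemma exDir_io (a : Fin 3) (m : ℕ) : ∃ n, m ≤ n ∧ exDir n = a := by
  have : ∃ j, tailDir 2 j = a := by
    fin_cases a
    · exact ⟨2, rfl⟩
    · exact ⟨1, rfl⟩
    · exact ⟨0, rfl⟩
  obtain ⟨j, hj⟩ := this
  exact ⟨j + 3 * m + 5, by omega, (tailDir_add m j).trans hj⟩

lemma sq_ge (x m : ℤ) (hm : 0 ≤ m) (h : m ≤ x) : m ^ 2 ≤ x ^ 2 := by nlinarith

lemma final_bound (X Y Z c1 c2 c3 c4 c5 a4 a3 a2 a1 a0 : ℤ) (h : qf Z Y X ≤ 288)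
    (e4 : a4 = X + Y + Z + c5) (e3 : a3 = a4 + Y + Z + c4) (e2 : a2 = a4 + a3 + Z + c3)
    (e1 : a1 = a2 + a3 + Z + c2) (e0 : a0 = a2 + a1 + Z + c1)
    (hs : a0 + a1 + Z = 0)
    (b1 : -2 ≤ c1 ∧ c1 ≤ 2) (b2 : -2 ≤ c2 ∧ c2 ≤ 2) (b3 : -2 ≤ c3 ∧ c3 ≤ 2)
    (b4 : -2 ≤ c4 ∧ c4 ≤ 2) (b5 : -2 ≤ c5 ∧ c5 ≤ 2) :
    a0 ≤ 3 ∧ a1 ≤ 3 ∧ Z ≤ 3 := by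
  have hq : (4*Z^2 - 16*Z*Y - 10*Z*X + 11*Y^2 + 2*Y*X + 9*X^2 : ℚ) ≤ 288 := by
    unfold qf at h; exact_mod_cast h
  have p1 : 20*Z + 13*Y + 8*X ≤ 38 := by omega
  have p2 : -38 ≤ 20*Z + 13*Y + 8*X := by omega
  have pp : (20*Z + 13*Y + 8*X)^2 ≤ 1444 := by nlinarith
  have hp : ((20*Z + 13*Y + 8*X)^2 : ℚ) ≤ 1444 := by exact_mod_cast pp
  refine ⟨?_, ?_, ?_⟩
  · by_contra hc
    have l : 10 ≤ X + Y := by omega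
    have l' : (100 : ℚ) ≤ (X + Y)^2 := by
      have : (100 : ℤ) ≤ (X + Y)^2 := sq_ge _ 10 (by norm_num) l
      exact_mod_cast this
    linarith [sq_nonneg (3044*Z - 1848*Y - 1165*X : ℚ), sq_nonneg (4387*Y - 2897*X : ℚ),
      sq_nonneg (X : ℚ)]
  · by_contra hc
    have l : 22 ≤ -3*Z + 3*Y + X := by omega
    have l' : (484 : ℚ) ≤ (-3*Z + 3*Y + X)^2 := by
      have : (484 : ℤ) ≤ (-3*Z + 3*Y + X)^2 := sq_ge _ 22 (by norm_num) l
      exact_mod_cast this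
    linarith [sq_nonneg (75914*Z + 68802*Y - 43495*X : ℚ), sq_nonneg (60109*Y + 10418*X : ℚ),
      sq_nonneg (X : ℚ)]
  · by_contra hc
    have l : 86 ≤ 11*Z - 13*Y - 8*X := by omega
    have l' : (7396 : ℚ) ≤ (11*Z - 13*Y - 8*X)^2 := by
      have : (7396 : ℤ) ≤ (11*Z - 13*Y - 8*X)^2 := sq_ge _ 86 (by norm_num) l
      exact_mod_cast this
    linarith [sq_nonneg (383039*Z + 172317*Y + 79355*X : ℚ),
      sq_nonneg (1029935*Y - 830584*X : ℚ), sq_nonneg (X : ℚ)]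

lemma ex_bound (n : ℕ) (u v : List (Fin 3)) (hu : u <:+: ARword exDir (n + 5))
    (hv : v <:+: ARword exDir (n + 5)) (hl : u.length = v.length) (j : Fin 3) :
    (u.count j : ℤ) - v.count j ≤ 3 := by
  rw [show n + 5 = n + 1 + 1 + 1 + 1 + 1 from rfl] at hu hv
  simp only [ARword_succ] at hu hv
  obtain ⟨u1, v1, c1, hu1, hv1, l1, m1, o1, s1⟩ := desub_pair (0 : Fin 3) _ _ u v hu hv
  obtain ⟨u2, v2, c2, hu2, hv2, l2, m2, o2, s2⟩ := desub_pair (1 : Fin 3) _ _ u1 v1 hu1 hv1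
  obtain ⟨u3, v3, c3, hu3, hv3, l3, m3, o3, s3⟩ := desub_pair (0 : Fin 3) _ _ u2 v2 hu2 hv2
  obtain ⟨u4, v4, c4, hu4, hv4, l4, m4, o4, s4⟩ := desub_pair (1 : Fin 3) _ _ u3 v3 hu3 hv3
  obtain ⟨u5, v5, c5, hu5, hv5, l5, m5, o5, s5⟩ := desub_pair (0 : Fin 3) _ _ u4 v4 hu4 hv4
  have hq : qf (dc u5 v5 2) (dc u5 v5 1) (dc u5 v5 0) ≤ 288 := tail_bound n 2 u5 v5 hu5 hv5
  have o11 := o1 1 (by decide)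
  have o12 := o1 2 (by decide)
  have o20 := o2 0 (by decide)
  have o22 := o2 2 (by decide)
  have o31 := o3 1 (by decide)
  have o32 := o3 2 (by decide)
  have o40 := o4 0 (by decide)
  have o42 := o4 2 (by decide)
  have o51 := o5 1 (by decide)
  have o52 := o5 2 (by decide)
  rw [length_eq_counts u, length_eq_counts v] at hl
  unfold dc at hq
  obtain ⟨r0, r1, r2⟩ := final_bound _ _ _ c1 c2 c3 c4 c5
    ((u4.count 0 : ℤ) - v4.count 0) ((u3.count 1 : ℤ) - v3.count 1)
    ((u2.count 0 : ℤ) - v2.count 0) ((u1.count 1 : ℤ) - v1.count 1)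
    ((u.count 0 : ℤ) - v.count 0) hq (by linarith) (by linarith) (by linarith) (by linarith)
    (by linarith) (by omega) ⟨l1, m1⟩ ⟨l2, m2⟩ ⟨l3, m3⟩ ⟨l4, m4⟩ ⟨l5, m5⟩
  fin_cases j
  · exact r0
  · show (u.count 1 : ℤ) - v.count 1 ≤ 3
    linarith
  · show (u.count 2 : ℤ) - v.count 2 ≤ 3
    linarith

lemma ex_balanced : IsBalanced 3 (limWord exDir) := by
  intro u v hu hv hl j
  rw [limWord_factor exDir exDir_ne] at hu hv
  obtain ⟨m, hu⟩ := hu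
  obtain ⟨n, hv⟩ := hv
  have hu' : u <:+: ARword exDir (m + n + 5) :=
    hu.trans (ARword_prefix exDir (by omega)).isInfix
  have hv' : v <:+: ARword exDir (m + n + 5) :=
    hv.trans (ARword_prefix exDir (by omega)).isInfix
  have h1 := ex_bound _ u v hu' hv' hl j
  have h2 := ex_bound _ v u hv' hu' hl.symm j
  rw [abs_le]
  constructor <;> push_cast <;> linarith

lemma ex_isAR : IsAR (limWord exDir) exDir :=
  ⟨exDir_io, limWord_factor exDir exDir_ne⟩

/-- Any Arnoux-Rauzy word whose directive sequence starts with `12121`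
(i.e. `0,1,0,1,0` in our `Fin 3` encoding of the letters 1,2,3) is not
`2`-balanced; moreover there exist Arnoux-Rauzy words with all weak partial
quotients equal to 1 (no two consecutive equal letters in the directive
sequence) that are `3`-balanced but not `2`-balanced. Hence the bound `2h+1`
of Theorem 1 is optimal for `h = 1`. -/
theorem optimality_for_h_one :
    (∀ ω dir : ℕ → Fin 3, IsAR ω dir →
      dir 0 = 0 → dir 1 = 1 → dir 2 = 0 → dir 3 = 1 → dir 4 = 0 →
      ¬ IsBalanced 2 ω) ∧
    (∃ ω dir : ℕ → Fin 3, IsAR ω dir ∧ (∀ m, dir m ≠ dir (m + 1)) ∧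
      IsBalanced 3 ω ∧ ¬ IsBalanced 2 ω) := by
  refine ⟨fun ω D h h0 h1 h2 h3 h4 => not_two_balanced ω D h h0 h1 h2 h3 h4,
    limWord exDir, exDir, ex_isAR, exDir_ne, ex_balanced, ?_⟩
  exact not_two_balanced _ _ ex_isAR rfl rfl rfl rfl rfl
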